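/- arXiv:2104.02346 — 3 statements merged into one kernel-verified Lean document; each statement's English description precedes it below -/
import Mathlib

section
/- Let u_X, u_Y be real numbers with u_X + u_Y ≥ 0 (a viable agreement). Then for all claims v_X, v_Y ∈ ℝ, the Nash bargaining product satisfies 𝒩(u_X, u_Y, v_X, v_Y) ≤ 𝒩(u_X, u_Y, u_X, u_Y) = ((u_X + u_Y)/2)². That is, truthful claims (v_X = u_X, v_Y = u_Y) achieve the optimal Nash bargaining product. -/
/-- The Nash bargaining product: `(u_X − (v_X − v_Y)/2)·(u_Y + (v_X − v_Y)/2)` if the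
claims satisfy `v_X + v_Y ≥ 0` (agreement concluded), and `0` otherwise. -/
noncomputable def nashProduct (uX uY vX vY : ℝ) : ℝ :=
  if vX + vY ≥ 0 then (uX - (vX - vY) / 2) * (uY + (vX - vY) / 2) else 0

/-- For a viable agreement (`u_X + u_Y ≥ 0`), truthful claims achieve the optimal
Nash bargaining product: for all claims `v_X, v_Y`,
`𝒩(u_X, u_Y, v_X, v_Y) ≤ 𝒩(u_X, u_Y, u_X, u_Y) = ((u_X + u_Y)/2)²`. -/
theorem truthful_claims_optimal (uX uY : ℝ) (h : uX + uY ≥ 0) :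
    (∀ vX vY : ℝ, nashProduct uX uY vX vY ≤ nashProduct uX uY uX uY) ∧
    nashProduct uX uY uX uY = ((uX + uY) / 2) ^ 2 := by
  have truthful : nashProduct uX uY uX uY = ((uX + uY) / 2) ^ 2 := by
    rw [nashProduct, if_pos h]
    ring
  refine ⟨fun vX vY => ?_, truthful⟩
  rw [truthful, nashProduct]
  split_ifs
  · nlinarith [sq_nonneg (uX - uY - (vX - vY))]
  · positivity
end

section
/- (Strong individual rationality.) Let V_X be a finite set of real claims available to party X in addition to the cancellation option (whose expected utility is 0), let V_Y be a finite set of real claims of party Y with weight function w, and let u_X ∈ ℝ. Suppose v_X ∈ V_X maximizes X's expected after-negotiation utility, i.e., E(u_X, v_X) ≥ 0 and E(u_X, v_X) ≥ E(u_X, v) for all v ∈ V_X. Let v_Y° ∈ V_Y be a claim of Y with w(v_Y°) > 0 and v_Y° ≥ −v_X (so the agreement is concluded), and suppose there exists an alternative claim v_X' ∈ V_X with v_X' < v_X such that {v_Y ∈ V_Y : v_Y ≥ −v_X'} = {v_Y ∈ V_Y : v_Y > v_Y°} (a claim cutting off exactly at v_Y°). Then the realized after-negotiation utility of X is nonnegative: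 u_X − (v_X − v_Y°)/2 ≥ 0. -/
/-- The expected after-negotiation utility of party X with true utility `u`
committing claim `v`, against party Y's finite choice set `VY` with weights `w`:
the agreement is concluded against `v_Y` exactly when `v_Y ≥ −v`, with cash
transfer `(v − v_Y)/2` from X to Y. -/
noncomputable def expectedUtility (VY : Finset ℝ) (w : ℝ → ℝ) (u v : ℝ) : ℝ :=
  ∑ vY ∈ VY.filter (fun vY => vY ≥ -v), w vY * (u - (v - vY) / 2)

/-- **Strong individual rationality.** If `v_X` maximizes X's expected
after-negotiation utility (which is nonnegative, cancellation yielding `0`),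
`v_Y°` is a claim of Y with positive weight against which the agreement is
concluded, and `V_X` contains an alternative claim `v_X' < v_X` cutting off
exactly at `v_Y°`, then the realized after-negotiation utility of X against
`v_Y°` is nonnegative. -/
theorem strong_individual_rationality (VX VY : Finset ℝ) (w : ℝ → ℝ)
    (hw : ∀ v ∈ VY, 0 ≤ w v) (uX vX : ℝ) (hvX : vX ∈ VX)
    (hnonneg : 0 ≤ expectedUtility VY w uX vX)
    (hbest : ∀ v ∈ VX, expectedUtility VY w uX v ≤ expectedUtility VY w uX vX)
    (vY0 : ℝ) (hvY0 : vY0 ∈ VY) (hw0 : 0 < w vY0) (hconc : vY0 ≥ -vX)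
    (vX' : ℝ) (hvX' : vX' ∈ VX) (hlt : vX' < vX)
    (hcut : VY.filter (fun vY => vY ≥ -vX') = VY.filter (fun vY => vY > vY0)) :
    0 ≤ uX - (vX - vY0) / 2 := by
  by_contra! hneg
  refine (hbest vX' hvX').not_gt ?_
  unfold expectedUtility
  rw [hcut, Finset.sum_filter, Finset.sum_filter]
  refine Finset.sum_lt_sum (fun v hv => ?_) ⟨vY0, hvY0, ?_⟩
  · have hwv := hw v hv
    rcases lt_or_ge vY0 v with h | h
    · rw [if_pos (hconc.le.trans h.le), if_pos h]
      exact mul_le_mul_of_nonneg_left (by linarith) hwv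
    · rw [if_neg h.not_gt]
      split_ifs
      · exact mul_nonpos_of_nonneg_of_nonpos hwv (by linarith)
      · exact le_rfl
  · rw [if_pos hconc, if_neg (lt_irrefl vY0)]
    exact mul_neg_of_pos_of_neg hw0 hneg
end

section
/- Let σ_X, σ_Y : ℝ → ℝ be strategies satisfying strong individual rationality: for all u_X, u_Y ∈ ℝ, if σ_X(u_X) + σ_Y(u_Y) ≥ 0 then u_X − Π ≥ 0 and u_Y + Π ≥ 0, where Π = (σ_X(u_X) − σ_Y(u_Y))/2. Then for all u_X, u_Y ∈ ℝ, the equilibrium Nash bargaining product is bounded between 0 and the truthful Nash bargaining product: 0 ≤ 𝒩(u_X, u_Y, σ_X(u_X), σ_Y(u_Y)) ≤ 𝒩(u_X, u_Y, u_X, u_Y). -/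
/-- If the strategy pair `(σ_X, σ_Y)` satisfies strong individual rationality, then
for all true utilities the equilibrium Nash bargaining product is bounded between `0`
and the truthful Nash bargaining product. -/
theorem equilibrium_nash_product_bounds (σX σY : ℝ → ℝ)
    (hSIR : ∀ uX uY : ℝ, σX uX + σY uY ≥ 0 →
      uX - (σX uX - σY uY) / 2 ≥ 0 ∧ uY + (σX uX - σY uY) / 2 ≥ 0) :
    ∀ uX uY : ℝ,
      0 ≤ nashProduct uX uY (σX uX) (σY uY) ∧
      nashProduct uX uY (σX uX) (σY uY) ≤ nashProduct uX uY uX uY := by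
  intro uX uY
  unfold nashProduct
  by_cases hv : σX uX + σY uY ≥ 0
  · obtain ⟨hX, hY⟩ := hSIR uX uY hv
    have hu : uX + uY ≥ 0 := by linarith
    rw [if_pos hv, if_pos hu]
    refine ⟨mul_nonneg hX hY, ?_⟩
    nlinarith [sq_nonneg (uX - uY - (σX uX - σY uY))]
  · rw [if_neg hv]
    refine ⟨le_rfl, ?_⟩
    split_ifs
    · nlinarith [sq_nonneg (uX + uY)]
    · exact le_rfl
end
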